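/- Let X be a Banach space of type p with 1 < p ≤ 2, let S : l_1 → X be a bounded linear operator, and let D_σ : l_1 → l_1 be the diagonal operator induced by a non-increasing, non-negative sequence σ = (σ_n). Let T = S D_σ. If p' < r < ∞, 0 < s ≤ ∞ and β ∈ ℝ, then (σ_{2^{n−1}})_n ∈ l_{r,s,β} implies (e_n(T))_n ∈ l_{r,s,β}. -/

import Mathlib

open MeasureTheory

/-- The `n`-th entropy number of a subset `A` of a pseudometric space. -/
noncomputable def entropyNum {X : Type*} [PseudoMetricSpace X] (A : Set X) (n : ℕ) : ℝ :=
  sInf {ε : ℝ | 0 ≤ ε ∧ ∃ T : Finset X, T.card ≤ n ∧ A ⊆ ⋃ x ∈ T, Metric.closedBall x ε}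

/-- The `n`-th dyadic entropy number of a subset `A`. -/
noncomputable def dyadEntropyNum {X : Type*} [PseudoMetricSpace X] (A : Set X) (n : ℕ) : ℝ :=
  entropyNum A (2 ^ (n - 1))

/-- The `n`-th entropy number of a bounded linear operator. -/
noncomputable def opEntropyNum {X Y : Type*} [SeminormedAddCommGroup X] [SeminormedAddCommGroup Y]
    [NormedSpace ℝ X] [NormedSpace ℝ Y] (T : X →L[ℝ] Y) (n : ℕ) : ℝ :=
  entropyNum (T '' Metric.closedBall 0 1) n

/-- The `n`-th dyadic entropy number of a bounded linear operator. -/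
noncomputable def opDyadEntropyNum {X Y : Type*} [SeminormedAddCommGroup X]
    [SeminormedAddCommGroup Y] [NormedSpace ℝ X] [NormedSpace ℝ Y]
    (T : X →L[ℝ] Y) (n : ℕ) : ℝ :=
  opEntropyNum T (2 ^ (n - 1))

/-- The absolutely convex hull of a set: all finite sums `∑ λ i • a i` with `∑ |λ i| ≤ 1`. -/
def absConvHull {X : Type*} [AddCommGroup X] [Module ℝ X] (A : Set X) : Set X :=
  {x | ∃ (n : ℕ) (a : Fin n → X) (lam : Fin n → ℝ),
    (∀ i, a i ∈ A) ∧ (∑ i, |lam i|) ≤ 1 ∧ x = ∑ i, lam i • a i}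

/-- The `i`-th Rademacher function. -/
noncomputable def rademacherFn (i : ℕ) (t : ℝ) : ℝ :=
  Real.sign (Real.sin (2 ^ i * Real.pi * t))

/-- `X` is of type `p` with constant `ρ`. -/
def IsTypePWith (X : Type*) [SeminormedAddCommGroup X] [NormedSpace ℝ X] (p ρ : ℝ) : Prop :=
  ∀ (k : ℕ) (x : Fin k → X),
    (∫ t in (0:ℝ)..1, ‖∑ i : Fin k, rademacherFn (i.1 + 1) t • x i‖) ≤
      ρ * (∑ i : Fin k, ‖x i‖ ^ p) ^ (1 / p)

/-- `X` is a Banach space of type `p`. -/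
def IsTypeP (X : Type*) [SeminormedAddCommGroup X] [NormedSpace ℝ X] (p : ℝ) : Prop :=
  ∃ ρ > 0, IsTypePWith X p ρ

/-- Membership in the generalized Lorentz sequence space `l_{r,s,α}`, `0 < s < ∞`:
`∑_{n ≥ 1} (log₂(n+1))^{-αs} n^{s/r-1} ξ_n^s < ∞`. -/
def MemLorentz (r s α : ℝ) (ξ : ℕ → ℝ) : Prop :=
  Summable fun n : ℕ =>
    (Real.logb 2 ((n : ℝ) + 2)) ^ (-(α * s)) * ((n : ℝ) + 1) ^ (s / r - 1) * ξ (n + 1) ^ s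

/-- Membership in the generalized Lorentz sequence space `l_{r,∞,α}`:
`sup_{n ≥ 1} (log₂(n+1))^{-α} n^{1/r} ξ_n < ∞`. -/
def MemLorentzTop (r α : ℝ) (ξ : ℕ → ℝ) : Prop :=
  ∃ C : ℝ, ∀ n : ℕ, 1 ≤ n →
    (Real.logb 2 ((n : ℝ) + 1)) ^ (-α) * (n : ℝ) ^ (1 / r) * ξ n ≤ C

/-- The `n`-th Kolmogorov number of a bounded linear operator. -/
noncomputable def kolmogorovNum {X Y : Type*} [SeminormedAddCommGroup X] [NormedSpace ℝ X]
    [NormedAddCommGroup Y] [NormedSpace ℝ Y] (T : X →L[ℝ] Y) (n : ℕ) : ℝ :=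
  sInf {c : ℝ | ∃ F : Submodule ℝ Y, Module.rank ℝ F < (n : Cardinal) ∧
    ∀ x ∈ Metric.closedBall (0 : X) 1, Metric.infDist (T x) (F : Set Y) ≤ c}

/-- The `l`-norm of an operator from a finite-dimensional Euclidean space. -/
noncomputable def ellNormFin {Y : Type*} [SeminormedAddCommGroup Y] [NormedSpace ℝ Y] {n : ℕ}
    (S : EuclideanSpace ℝ (Fin n) →L[ℝ] Y) : ℝ :=
  (∫ x : Fin n → ℝ, ‖S ((WithLp.equiv 2 (Fin n → ℝ)).symm x)‖ ^ 2
      ∂(Measure.pi fun _ : Fin n => ProbabilityTheory.gaussianReal 0 1)) ^ ((1 : ℝ) / 2)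

/-- The `l`-norm of an operator between Banach spaces. -/
noncomputable def ellNorm {X Y : Type*} [SeminormedAddCommGroup X] [NormedSpace ℝ X]
    [SeminormedAddCommGroup Y] [NormedSpace ℝ Y] (T : X →L[ℝ] Y) : ℝ :=
  sSup {c : ℝ | ∃ (n : ℕ) (A : EuclideanSpace ℝ (Fin n) →L[ℝ] X),
    ‖A‖ ≤ 1 ∧ c = ellNormFin (T.comp A)}

/-- The `n`-th approximation number of `T` with respect to the `l`-norm. -/
noncomputable def approxNumEll {X Y : Type*} [SeminormedAddCommGroup X] [NormedSpace ℝ X]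
    [SeminormedAddCommGroup Y] [NormedSpace ℝ Y] (T : X →L[ℝ] Y) (n : ℕ) : ℝ :=
  sInf {c : ℝ | ∃ A : X →L[ℝ] Y,
    Module.rank ℝ (LinearMap.range (A : X →ₗ[ℝ] Y)) < (n : Cardinal) ∧ c = ellNorm (T - A)}

/-- `A` is covered by at most `N` closed balls of radius `ε`. -/
def CoveredBy {X : Type*} [PseudoMetricSpace X] (A : Set X) (N : ℕ) (ε : ℝ) : Prop :=
  ∃ T : Finset X, T.card ≤ N ∧ A ⊆ ⋃ x ∈ T, Metric.closedBall x ε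

section Maurey

variable {X : Type*} [NormedAddCommGroup X] [NormedSpace ℝ X]

lemma measurable_rademacherFn (i : ℕ) : Measurable (rademacherFn i) := by
  have h : Measurable Real.sign := by
    unfold Real.sign
    exact Measurable.ite measurableSet_Iio measurable_const
      (Measurable.ite measurableSet_Ioi measurable_const measurable_const)
  exact h.comp (by fun_prop)

lemma abs_rademacherFn_le (i : ℕ) (t : ℝ) : |rademacherFn i t| ≤ 1 := by
  unfold rademacherFn
  rcases Real.sign_apply_eq (Real.sin (2 ^ i * Real.pi * t)) with h | h | h <;> simp [h]

lemma ae_rademacherFn_ne_zero (i : ℕ) : ∀ᵐ t : ℝ, rademacherFn i t ≠ 0 := by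
  have hsub : {t : ℝ | ¬ rademacherFn i t ≠ 0} ⊆ Set.range fun n : ℤ => (n : ℝ) / 2 ^ i := by
    intro t ht
    have h0 : rademacherFn i t = 0 := by simpa using ht
    obtain ⟨n, hn⟩ := Real.sin_eq_zero_iff.mp (Real.sign_eq_zero_iff.mp h0)
    refine ⟨n, ?_⟩
    have hpi := Real.pi_ne_zero
    have h2 : (2 : ℝ) ^ i ≠ 0 := by positivity
    have : (n : ℝ) = 2 ^ i * t := by
      apply mul_right_cancel₀ hpi
      rw [hn]; ring
    simp only [this]
    field_simp
  exact (ae_iff).2 (((Set.countable_range _).mono hsub).measure_zero _)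

lemma intervalIntegrable_rademacher_sum {k : ℕ} (x : Fin k → X) :
    IntervalIntegrable (fun t => ‖∑ i : Fin k, rademacherFn (i.1 + 1) t • x i‖) volume 0 1 := by
  have hm : StronglyMeasurable fun t => ∑ i : Fin k, rademacherFn (i.1 + 1) t • x i :=
    Finset.stronglyMeasurable_fun_sum _ fun i _ =>
      (measurable_rademacherFn _).stronglyMeasurable.smul_const (x i)
  rw [intervalIntegrable_iff_integrableOn_Ioc_of_le zero_le_one]
  refine Measure.integrableOn_of_bounded (M := ∑ i : Fin k, ‖x i‖) (by simp)
    hm.norm.aestronglyMeasurable (Filter.Eventually.of_forall fun t => ?_)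
  rw [norm_norm]
  refine (norm_sum_le _ _).trans (Finset.sum_le_sum fun i _ => ?_)
  rw [norm_smul, Real.norm_eq_abs]
  exact mul_le_of_le_one_left (norm_nonneg _) (abs_rademacherFn_le _ _)

lemma sum_pi_prod {ι : Type*} [Fintype ι] {l : ℕ} (h : Fin l → ι → ℝ) :
    ∑ f : Fin l → ι, ∏ k, h k (f k) = ∏ k, ∑ i, h k i := by
  classical
  rw [Finset.prod_univ_sum, Fintype.piFinset_univ]

lemma sum_pi_prod_smul {ι : Type*} [Fintype ι] {l : ℕ} {w : ι → ℝ} (hw : ∑ i, w i = 1)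
    (z : ι → X) (k : Fin l) :
    ∑ f : Fin l → ι, (∏ j, w (f j)) • z (f k) = ∑ i, w i • z i := by
  classical
  have h1 : ∀ f : Fin l → ι, (∏ j, w (f j)) • z (f k) =
      ∑ i, (∏ j, w (f j) * if j = k then (if f j = i then 1 else 0) else 1) • z i := by
    intro f
    have : ∀ i, (∏ j, w (f j) * if j = k then (if f j = i then (1 : ℝ) else 0) else 1) =
        (∏ j, w (f j)) * if f k = i then 1 else 0 := by
      intro i
      rw [Finset.prod_mul_distrib, Finset.prod_ite_eq' Finset.univ k]
      simp
    rw [Finset.sum_congr rfl fun i _ => by rw [this i]]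
    simp
  simp_rw [h1]
  rw [Finset.sum_comm]
  refine Finset.sum_congr rfl fun i _ => ?_
  rw [← Finset.sum_smul,
    sum_pi_prod fun j a => w a * if j = k then (if a = i then (1 : ℝ) else 0) else 1]
  congr 1
  rw [Finset.prod_eq_single k]
  · simp
  · intro j _ hj
    simp [hj, hw]
  · simp

/-- The expected norm of a symmetrised sum of independent vectors in a space of type `p`. -/
lemma sum_symm_le {ι : Type*} [Fintype ι] {p ρ : ℝ} (hp : 0 < p) (hρ : 0 ≤ ρ)
    (hX : IsTypePWith X p ρ)
    {w : ι → ℝ} (hw0 : ∀ i, 0 ≤ w i) (hw : ∑ i, w i = 1) {z : ι → X} {M : ℝ}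
    (hz : ∀ i, ‖z i‖ ≤ M) (l : ℕ) :
    ∑ h : Fin l → ι × ι, (∏ k, (w (h k).1 * w (h k).2)) * ‖∑ k, (z (h k).1 - z (h k).2)‖ ≤
      ρ * (l * (2 * M) ^ p) ^ (1 / p) := by
  classical
  set W : (Fin l → ι × ι) → ℝ := fun h => ∏ k, (w (h k).1 * w (h k).2) with hW
  have hW0 : ∀ h, 0 ≤ W h := fun h =>
    Finset.prod_nonneg fun k _ => mul_nonneg (hw0 _) (hw0 _)
  have hW1 : ∑ h, W h = 1 := by
    rw [hW, sum_pi_prod fun _ (a : ι × ι) => w a.1 * w a.2]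
    apply Finset.prod_eq_one
    intro k _
    rw [Fintype.sum_prod_type, ← Finset.sum_mul_sum, hw, one_mul]
  have hsign : ∀ᵐ t : ℝ, ∑ h, W h * ‖∑ k, (z (h k).1 - z (h k).2)‖ =
      ∑ h, W h * ‖∑ k : Fin l, rademacherFn (k.1 + 1) t • (z (h k).1 - z (h k).2)‖ := by
    have : ∀ᵐ t : ℝ, ∀ k : Fin l, rademacherFn (k.1 + 1) t ≠ 0 :=
      ae_all_iff.2 fun k => ae_rademacherFn_ne_zero _
    filter_upwards [this] with t ht
    have ht' : ∀ k : Fin l, rademacherFn (k.1 + 1) t = 1 ∨ rademacherFn (k.1 + 1) t = -1 := by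
      intro k
      have := ht k
      unfold rademacherFn at this ⊢
      rcases Real.sign_apply_eq (Real.sin (2 ^ (k.1 + 1) * Real.pi * t)) with h | h | h
      · exact Or.inr h
      · exact absurd h this
      · exact Or.inl h
    let e : (Fin l → ι × ι) ≃ (Fin l → ι × ι) :=
      Equiv.piCongrRight fun k =>
        if rademacherFn (k.1 + 1) t = 1 then Equiv.refl _ else Equiv.prodComm ι ι
    refine Fintype.sum_equiv e _ _ fun h => ?_
    have he1 : ∀ k, w (e h k).1 * w (e h k).2 = w (h k).1 * w (h k).2 := by
      intro k
      simp only [e, Equiv.piCongrRight_apply, Pi.map_apply]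
      split_ifs
      · rfl
      · simp [mul_comm]
    have he2 : ∀ k, rademacherFn (k.1 + 1) t • (z (e h k).1 - z (e h k).2) =
        z (h k).1 - z (h k).2 := by
      intro k
      simp only [e, Equiv.piCongrRight_apply, Pi.map_apply]
      rcases ht' k with h1 | h1
      · simp [h1]
      · have : ¬ ((-1 : ℝ) = 1) := by norm_num
        simp [h1, this]
    simp only [hW, he1, he2]
  have hint : ∑ h, W h * ‖∑ k, (z (h k).1 - z (h k).2)‖ =
      ∑ h, W h * ∫ t in (0 : ℝ)..1,
        ‖∑ k : Fin l, rademacherFn (k.1 + 1) t • (z (h k).1 - z (h k).2)‖ := by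
    have h1 : ∫ _t in (0 : ℝ)..1, ∑ h, W h * ‖∑ k, (z (h k).1 - z (h k).2)‖ =
        ∑ h, W h * ‖∑ k, (z (h k).1 - z (h k).2)‖ := by simp
    rw [← h1, intervalIntegral.integral_congr_ae (hsign.mono fun t ht _ => ht),
      intervalIntegral.integral_finsetSum
        fun h _ => (intervalIntegrable_rademacher_sum _).const_mul _]
    simp_rw [intervalIntegral.integral_const_mul]
  rw [hint]
  calc _ ≤ ∑ h, W h * (ρ * (l * (2 * M) ^ p) ^ (1 / p)) := by
        refine Finset.sum_le_sum fun h _ => mul_le_mul_of_nonneg_left ?_ (hW0 h)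
        refine (hX l _).trans (mul_le_mul_of_nonneg_left ?_ hρ)
        refine Real.rpow_le_rpow (Finset.sum_nonneg fun i _ => by positivity) ?_ (by positivity)
        calc _ ≤ ∑ _k : Fin l, (2 * M) ^ p := Finset.sum_le_sum fun k _ =>
              Real.rpow_le_rpow (norm_nonneg _)
                ((norm_sub_le _ _).trans (by linarith [hz (h k).1, hz (h k).2])) hp.le
          _ = _ := by simp
    _ = _ := by rw [← Finset.sum_mul, hW1, one_mul]

/-- Maurey's empirical approximation of a convex combination in a space of type `p`. -/
lemma exists_empirical_approx {ι : Type*} [Fintype ι] {p ρ : ℝ} (hp : 0 < p) (hρ : 0 ≤ ρ)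
    (hX : IsTypePWith X p ρ)
    {w : ι → ℝ} (hw0 : ∀ i, 0 ≤ w i) (hw : ∑ i, w i = 1) {z : ι → X} {M : ℝ}
    (hz : ∀ i, ‖z i‖ ≤ M) (l : ℕ) :
    ∃ f : Fin l → ι, ‖(l : ℝ) • (∑ i, w i • z i) - ∑ k, z (f k)‖ ≤
      ρ * (l * (2 * M) ^ p) ^ (1 / p) := by
  classical
  set W : (Fin l → ι) → ℝ := fun f => ∏ k, w (f k) with hW
  have hW0 : ∀ f, 0 ≤ W f := fun f => Finset.prod_nonneg fun k _ => hw0 _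
  have hW1 : ∑ f, W f = 1 := by
    rw [hW, sum_pi_prod fun _ a => w a]
    simp [hw]
  have hmean : ∀ f : Fin l → ι, (l : ℝ) • (∑ i, w i • z i) - ∑ k, z (f k) =
      ∑ g : Fin l → ι, W g • ∑ k, (z (g k) - z (f k)) := by
    intro f
    simp_rw [Finset.sum_sub_distrib, smul_sub]
    rw [Finset.sum_sub_distrib, ← Finset.sum_smul, hW1, one_smul]
    congr 1
    simp_rw [Finset.smul_sum]
    rw [Finset.sum_comm]
    simp_rw [hW, sum_pi_prod_smul hw z]
    simp [← Nat.cast_smul_eq_nsmul ℝ, Finset.smul_sum]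
  have hle : ∑ f, W f * ‖(l : ℝ) • (∑ i, w i • z i) - ∑ k, z (f k)‖ ≤
      ρ * (l * (2 * M) ^ p) ^ (1 / p) := by
    refine le_trans ?_ (sum_symm_le hp hρ hX hw0 hw hz l)
    rw [← (Equiv.arrowProdEquivProdArrow (Fin l) (fun _ => ι) (fun _ => ι)).symm.sum_comp,
      Fintype.sum_prod_type_right]
    refine Finset.sum_le_sum fun f _ => ?_
    rw [hmean f]
    refine (mul_le_mul_of_nonneg_left (norm_sum_le _ _) (hW0 f)).trans ?_
    rw [Finset.mul_sum]
    refine Finset.sum_le_sum fun g _ => le_of_eq ?_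
    rw [norm_smul, Real.norm_of_nonneg (hW0 g)]
    simp [Equiv.arrowProdEquivProdArrow, hW, Finset.prod_mul_distrib]
    ring
  by_contra! hcon
  refine absurd hle (not_le.2 ?_)
  set B := ρ * (l * (2 * M) ^ p) ^ (1 / p)
  obtain ⟨f₀, -, hf₀⟩ : ∃ f ∈ Finset.univ, 0 < W f := by
    by_contra! hall
    have := Finset.sum_nonpos hall
    linarith
  calc B = ∑ f, W f * B := by rw [← Finset.sum_mul, hW1, one_mul]
    _ < _ := Finset.sum_lt_sum (fun f _ => mul_le_mul_of_nonneg_left (hcon f).le (hW0 f))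
      ⟨f₀, Finset.mem_univ _, mul_lt_mul_of_pos_left (hcon f₀) hf₀⟩

/-- Covering the convex hull of finitely many points in a space of type `p`. -/
lemma coveredBy_convexHull {p ρ : ℝ} (hp : 0 < p) (hρ : 0 ≤ ρ) (hX : IsTypePWith X p ρ)
    (P : Finset X) {M : ℝ} (hM : 0 ≤ M) (hP : ∀ x ∈ P, ‖x‖ ≤ M) {l : ℕ} (hl : 0 < l) :
    CoveredBy (convexHull ℝ (P : Set X)) (P.card ^ l) (2 * ρ * M * (l : ℝ) ^ (1 / p - 1)) := by
  classical
  refine ⟨Finset.univ.image fun f : Fin l → P => (l : ℝ)⁻¹ • ∑ k, (f k : X), ?_, ?_⟩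
  · exact Finset.card_image_le.trans (by simp)
  · intro x hx
    obtain ⟨w, hw0, hw1, hwx⟩ := Finset.mem_convexHull'.1 hx
    rw [← Finset.sum_coe_sort P] at hw1 hwx
    obtain ⟨f, hf⟩ := exists_empirical_approx (ι := P) hp hρ hX (w := fun y => w y)
      (fun y => hw0 y y.2) hw1 (z := fun y => (y : X)) (fun y => hP y y.2) l
    rw [hwx] at hf
    simp only [Set.mem_iUnion, Finset.mem_image, Finset.mem_univ, true_and]
    refine ⟨_, ⟨f, rfl⟩, ?_⟩
    have hl' : (0 : ℝ) < l := by exact_mod_cast hl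
    rw [mem_closedBall_iff_norm]
    have h1 : x - (l : ℝ)⁻¹ • ∑ k, (f k : X) = (l : ℝ)⁻¹ • ((l : ℝ) • x - ∑ k, (f k : X)) := by
      rw [smul_sub, inv_smul_smul₀ hl'.ne']
    rw [h1, norm_smul, norm_inv, Real.norm_of_nonneg hl'.le]
    refine (mul_le_mul_of_nonneg_left hf (by positivity)).trans (le_of_eq ?_)
    rw [Real.mul_rpow hl'.le (by positivity), ← Real.rpow_mul (by positivity),
      mul_one_div_cancel hp.ne', Real.rpow_one, Real.rpow_sub_one hl'.ne']
    ring

end Maurey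

section Covering

variable {X : Type*} [NormedAddCommGroup X]

open scoped Pointwise in
lemma CoveredBy.add {A B : Set X} {N M : ℕ} {ε δ : ℝ} (hA : CoveredBy A N ε)
    (hB : CoveredBy B M δ) : CoveredBy (A + B) (N * M) (ε + δ) := by
  classical
  obtain ⟨T, hT, hAT⟩ := hA
  obtain ⟨U, hU, hBU⟩ := hB
  refine ⟨T + U, Finset.card_add_le.trans (Nat.mul_le_mul hT hU), ?_⟩
  rintro _ ⟨a, ha, b, hb, rfl⟩
  obtain ⟨t, ht, hat⟩ := Set.mem_iUnion₂.1 (hAT ha)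
  obtain ⟨u, hu, hbu⟩ := Set.mem_iUnion₂.1 (hBU hb)
  refine Set.mem_iUnion₂.2 ⟨t + u, Finset.add_mem_add ht hu, ?_⟩
  exact (dist_add_add_le _ _ _ _).trans (add_le_add hat hbu)

lemma CoveredBy.mono {A B : Set X} {N M : ℕ} {ε δ : ℝ} (hA : CoveredBy A N ε) (hBA : B ⊆ A)
    (hNM : N ≤ M) (h : ε ≤ δ) : CoveredBy B M δ := by
  obtain ⟨T, hT, hAT⟩ := hA
  exact ⟨T, hT.trans hNM, (hBA.trans hAT).trans
    (Set.iUnion₂_mono fun x _ => Metric.closedBall_subset_closedBall h)⟩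

lemma coveredBy_closedBall (ε : ℝ) : CoveredBy (Metric.closedBall (0 : X) ε) 1 ε :=
  ⟨{0}, by simp, by simp⟩

variable [NormedSpace ℝ X]

lemma sum_smul_mem_convexHull {ι : Type*} (I : Finset ι) (y : ι → X) (ξ : ι → ℝ)
    (hξ : ∑ i ∈ I, |ξ i| ≤ 1) {s : Set X} (h0 : 0 ∈ s) (hy : ∀ i ∈ I, y i ∈ s)
    (hy' : ∀ i ∈ I, -y i ∈ s) : ∑ i ∈ I, ξ i • y i ∈ convexHull ℝ s := by
  have hconv := convex_convexHull ℝ s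
  have hsub := subset_convexHull ℝ s
  have h1 : ∑ i ∈ I, ξ i • y i = ∑ i ∈ I, |ξ i| • (if 0 ≤ ξ i then y i else -y i) := by
    refine Finset.sum_congr rfl fun i _ => ?_
    split_ifs with h
    · rw [abs_of_nonneg h]
    · rw [abs_of_neg (not_le.1 h), smul_neg, neg_smul, neg_neg]
  rw [h1]
  rcases (Finset.sum_nonneg fun i (_ : i ∈ I) => abs_nonneg (ξ i)).eq_or_lt with hw | hw
  · have h2 := (Finset.sum_eq_zero_iff_of_nonneg fun i _ => abs_nonneg (ξ i)).1 hw.symm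
    rw [Finset.sum_eq_zero fun i hi => by rw [h2 i hi, zero_smul]]
    exact hsub h0
  · have hc : I.centerMass (fun i => |ξ i|) (fun i => if 0 ≤ ξ i then y i else -y i) ∈
        convexHull ℝ s := by
      refine hconv.centerMass_mem (fun i _ => abs_nonneg _) hw fun i hi => hsub ?_
      split_ifs
      exacts [hy i hi, hy' i hi]
    have := hconv.smul_mem_of_zero_mem (hsub h0) hc ⟨hw.le, hξ⟩
    rwa [Finset.centerMass, smul_inv_smul₀ hw.ne'] at this

/-- Covering the absolutely convex hull of a sequence of points split into blocks. -/
lemma coveredBy_sum_blocks {p ρ : ℝ} (hp : 0 < p) (hρ : 0 ≤ ρ) (hX : IsTypePWith X p ρ)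
    (y : ℕ → X) {m : ℕ → ℕ} (hm : Monotone m) (hm0 : m 0 = 0) {M : ℕ → ℝ} (hM0 : ∀ j, 0 ≤ M j)
    (hM : ∀ j i, m j ≤ i → ‖y i‖ ≤ M j) {l : ℕ → ℕ} (hl : ∀ j, 0 < l j) (J : ℕ) :
    CoveredBy {x | ∃ ξ : ℕ → ℝ, ∑ i ∈ Finset.range (m J), |ξ i| ≤ 1 ∧
        x = ∑ i ∈ Finset.range (m J), ξ i • y i}
      (∏ j ∈ Finset.range J, (2 * m (j + 1) + 1) ^ l j)
      (∑ j ∈ Finset.range J, 2 * ρ * M j * (l j : ℝ) ^ (1 / p - 1)) := by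
  classical
  induction J with
  | zero =>
    refine ⟨{0}, by simp, ?_⟩
    rintro x ⟨ξ, -, rfl⟩
    simp [hm0]
  | succ J ih =>
    rw [Finset.prod_range_succ, Finset.sum_range_succ]
    set I := Finset.Ico (m J) (m (J + 1)) with hI
    set P : Finset X := insert 0 (I.image y ∪ I.image fun i => -y i) with hP
    have hcard : P.card ≤ 2 * m (J + 1) + 1 := by
      have hIc : I.card ≤ m (J + 1) := by simp [hI]
      refine (Finset.card_insert_le _ _).trans (Nat.succ_le_succ ?_)
      refine (Finset.card_union_le _ _).trans ?_
      have h1 : (I.image y).card ≤ I.card := Finset.card_image_le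
      have h2 : (I.image fun i => -y i).card ≤ I.card := Finset.card_image_le
      omega
    have hPn : ∀ x ∈ P, ‖x‖ ≤ M J := by
      intro x hx
      simp only [hP, Finset.mem_insert, Finset.mem_union, Finset.mem_image] at hx
      rcases hx with rfl | ⟨i, hi, rfl⟩ | ⟨i, hi, rfl⟩
      · simpa using hM0 J
      · exact hM J i (Finset.mem_Ico.1 hi).1
      · rw [norm_neg]
        exact hM J i (Finset.mem_Ico.1 hi).1
    refine (ih.add (coveredBy_convexHull hp hρ hX P (hM0 J) hPn (hl J))).mono ?_
      (Nat.mul_le_mul_left _ (Nat.pow_le_pow_left hcard _)) le_rfl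
    rintro x ⟨ξ, hξ, rfl⟩
    rw [← Finset.sum_range_add_sum_Ico _ (hm J.le_succ)] at hξ ⊢
    have h1 := Finset.sum_nonneg fun i (_ : i ∈ Finset.range (m J)) => abs_nonneg (ξ i)
    have h2 := Finset.sum_nonneg fun i (_ : i ∈ I) => abs_nonneg (ξ i)
    refine Set.add_mem_add ⟨ξ, by linarith, rfl⟩
      (sum_smul_mem_convexHull I y ξ (by linarith) ?_ ?_ ?_)
    · simp [hP]
    · intro i hi
      simp only [hP, Finset.coe_insert, Finset.coe_union, Finset.coe_image]
      exact Or.inr (Or.inl ⟨i, hi, rfl⟩)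
    · intro i hi
      simp only [hP, Finset.coe_insert, Finset.coe_union, Finset.coe_image]
      exact Or.inr (Or.inr ⟨i, hi, rfl⟩)

local notation "ℓ¹" => lp (fun _ : ℕ => ℝ) 1

lemma hasSum_norm_lp_one (ξ : ℓ¹) : HasSum (fun i => |(ξ : ∀ _ : ℕ, ℝ) i|) ‖ξ‖ := by
  simpa using lp.hasSum_norm (p := 1) (by simp) ξ

open scoped Pointwise in
/-- The image of the unit ball under `S ∘ D_σ`: finitely many coordinates and a small tail. -/
lemma image_diagonal_subset {σ : ℕ → ℝ} (hσ0 : ∀ n, 0 ≤ σ n) (hσm : Antitone σ)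
    (S : ℓ¹ →L[ℝ] X) (D : ℓ¹ →L[ℝ] ℓ¹)
    (hD : ∀ (ξ : ℓ¹) (n : ℕ), (D ξ : ∀ _ : ℕ, ℝ) n = σ n * (ξ : ∀ _ : ℕ, ℝ) n) (m : ℕ) :
    (S.comp D) '' Metric.closedBall 0 1 ⊆
      {x | ∃ ξ : ℕ → ℝ, ∑ i ∈ Finset.range m, |ξ i| ≤ 1 ∧
        x = ∑ i ∈ Finset.range m, ξ i • S (D (lp.single 1 i (1 : ℝ)))} +
      Metric.closedBall (0 : X) (‖S‖ * σ m) := by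
  rintro _ ⟨ξ, hξ, rfl⟩
  have hξ1 : ‖ξ‖ ≤ 1 := by simpa using hξ
  have hs := hasSum_norm_lp_one ξ
  set η : ℓ¹ := ξ - ∑ i ∈ Finset.range m, (ξ : ∀ _ : ℕ, ℝ) i • lp.single 1 i (1 : ℝ) with hη
  have hηi : ∀ n, (η : ∀ _ : ℕ, ℝ) n = if n < m then 0 else (ξ : ∀ _ : ℕ, ℝ) n := by
    intro n
    rw [hη, lp.coeFn_sub, Pi.sub_apply, lp.coeFn_sum, Finset.sum_apply]
    simp only [lp.coeFn_smul, Pi.smul_apply, lp.single_apply, smul_eq_mul, Pi.single_apply,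
      mul_ite, mul_one, mul_zero, Finset.sum_ite_eq, Finset.mem_range]
    split_ifs <;> simp
  refine ⟨∑ i ∈ Finset.range m, (ξ : ∀ _ : ℕ, ℝ) i • S (D (lp.single 1 i (1 : ℝ))),
    ⟨ξ, (sum_le_hasSum _ (fun i _ => abs_nonneg _) hs).trans hξ1, rfl⟩, S (D η), ?_, ?_⟩
  · rw [mem_closedBall_zero_iff]
    refine (S.le_opNorm _).trans (mul_le_mul_of_nonneg_left ?_ (norm_nonneg _))
    refine hasSum_le_of_sum_le (hasSum_norm_lp_one (D η)) fun F => ?_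
    calc _ ≤ ∑ i ∈ F, σ m * |(ξ : ∀ _ : ℕ, ℝ) i| := by
          refine Finset.sum_le_sum fun i _ => ?_
          rw [hD, hηi, abs_mul, abs_of_nonneg (hσ0 i)]
          split_ifs with h
          · simpa using mul_nonneg (hσ0 m) (abs_nonneg _)
          · exact mul_le_mul_of_nonneg_right (hσm (not_lt.1 h)) (abs_nonneg _)
      _ = σ m * ∑ i ∈ F, |(ξ : ∀ _ : ℕ, ℝ) i| := by rw [Finset.mul_sum]
      _ ≤ σ m * 1 := mul_le_mul_of_nonneg_left
          ((sum_le_hasSum _ (fun i _ => abs_nonneg _) hs).trans hξ1) (hσ0 m)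
      _ = σ m := mul_one _
  · simp [hη, map_sum]

lemma norm_image_single_le {σ : ℕ → ℝ} (hσ0 : ∀ n, 0 ≤ σ n) (hσm : Antitone σ)
    (S : ℓ¹ →L[ℝ] X) (D : ℓ¹ →L[ℝ] ℓ¹)
    (hD : ∀ (ξ : ℓ¹) (n : ℕ), (D ξ : ∀ _ : ℕ, ℝ) n = σ n * (ξ : ∀ _ : ℕ, ℝ) n) {m i : ℕ}
    (hi : m ≤ i) : ‖S (D (lp.single 1 i (1 : ℝ)))‖ ≤ ‖S‖ * σ m := by
  have h1 : D (lp.single 1 i (1 : ℝ)) = σ i • lp.single 1 i (1 : ℝ) := by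
    ext n
    rw [hD, lp.coeFn_smul, Pi.smul_apply, lp.single_apply, smul_eq_mul]
    rcases eq_or_ne n i with rfl | h
    · rfl
    · simp [h]
  rw [h1]
  refine (S.le_opNorm _).trans (mul_le_mul_of_nonneg_left ?_ (norm_nonneg _))
  rw [norm_smul, lp.norm_single (by simp), Real.norm_of_nonneg (hσ0 i)]
  simpa using hσm hi

end Covering

section EntropyNumbers

lemma entropyNum_nonneg {X : Type*} [PseudoMetricSpace X] (A : Set X) (n : ℕ) :
    0 ≤ entropyNum A n :=
  Real.sInf_nonneg fun _ h => h.1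

lemma CoveredBy.entropyNum_le {X : Type*} [PseudoMetricSpace X] {A : Set X} {n : ℕ} {ε : ℝ}
    (hε : 0 ≤ ε) (h : CoveredBy A n ε) : entropyNum A n ≤ ε :=
  csInf_le ⟨0, fun _ h => h.1⟩ ⟨hε, h⟩

lemma opDyadEntropyNum_nonneg {X Y : Type*} [SeminormedAddCommGroup X]
    [SeminormedAddCommGroup Y] [NormedSpace ℝ X] [NormedSpace ℝ Y] (T : X →L[ℝ] Y) (n : ℕ) :
    0 ≤ opDyadEntropyNum T n :=
  entropyNum_nonneg _ _

lemma opDyadEntropyNum_antitone {X Y : Type*} [SeminormedAddCommGroup X]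
    [SeminormedAddCommGroup Y] [NormedSpace ℝ X] [NormedSpace ℝ Y] (T : X →L[ℝ] Y) :
    Antitone (opDyadEntropyNum T) := by
  intro a b hab
  refine csInf_le_csInf ⟨0, fun _ h => h.1⟩ ⟨‖T‖, norm_nonneg _, {0}, ?_, ?_⟩ ?_
  · simpa using Nat.one_le_two_pow
  · rintro _ ⟨ξ, hξ, rfl⟩
    have hξ1 : ‖ξ‖ ≤ 1 := by simpa using hξ
    simpa using (T.le_opNorm ξ).trans (mul_le_of_le_one_right (norm_nonneg _) hξ1)
  · rintro ε ⟨hε, U, hU, hAU⟩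
    exact ⟨hε, U, hU.trans (Nat.pow_le_pow_right (by norm_num) (by omega)), hAU⟩

end EntropyNumbers

section DyadicBound

lemma sum_pow_sub_le {x : ℝ} (hx0 : 0 ≤ x) (hx1 : x < 1) (J : ℕ) :
    ∑ j ∈ Finset.range (J + 1), x ^ (J - j) ≤ (1 - x)⁻¹ := by
  rw [Finset.sum_flip fun k => x ^ k, ← tsum_geometric_of_lt_one hx0 hx1]
  exact (summable_geometric_of_lt_one hx0 hx1).sum_le_tsum _ fun _ _ => pow_nonneg hx0 _

/-- A geometrically weighted sum is controlled by its largest term with slower decay. -/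
lemma exists_sum_pow_le {u v : ℝ} (hv : 0 < v) (hvu : v < u) {a : ℕ → ℝ} (ha : ∀ j, 0 ≤ a j)
    (J : ℕ) : ∃ j ≤ J, ∑ i ∈ Finset.range (J + 1), a i * v ^ (J - i) ≤
      (1 - v / u)⁻¹ * (a j * u ^ (J - j)) := by
  have hu : 0 < u := hv.trans hvu
  obtain ⟨j, hj, hmax⟩ := Finset.exists_max_image (Finset.range (J + 1))
    (fun j => a j * u ^ (J - j)) ⟨0, by simp⟩
  refine ⟨j, by simpa [Nat.lt_succ_iff] using hj, ?_⟩
  calc _ ≤ ∑ i ∈ Finset.range (J + 1), (v / u) ^ (J - i) * (a j * u ^ (J - j)) := by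
        refine Finset.sum_le_sum fun i hi => ?_
        have : a i * v ^ (J - i) = (v / u) ^ (J - i) * (a i * u ^ (J - i)) := by
          rw [div_pow]
          field_simp
        rw [this]
        exact mul_le_mul_of_nonneg_left (hmax i hi) (by positivity)
    _ = (∑ i ∈ Finset.range (J + 1), (v / u) ^ (J - i)) * (a j * u ^ (J - j)) := by
        rw [Finset.sum_mul]
    _ ≤ _ := mul_le_mul_of_nonneg_right
        (sum_pow_sub_le (by positivity) ((div_lt_one hu).2 hvu) J)
        (mul_nonneg (ha j) (by positivity))

/-- The endpoints `0, 1, 2, 8, 128, …` of doubly exponentially growing blocks. -/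
def blockStart : ℕ → ℕ
  | 0 => 0
  | j + 1 => 2 ^ (2 ^ j - 1)

lemma blockStart_monotone : Monotone blockStart := by
  refine monotone_nat_of_le_succ fun j => ?_
  cases j with
  | zero => simp [blockStart]
  | succ j =>
    refine Nat.pow_le_pow_right (by norm_num) (Nat.sub_le_sub_right ?_ 1)
    exact Nat.pow_le_pow_right (by norm_num) j.le_succ

lemma two_mul_blockStart_succ_add_one_le (j : ℕ) :
    2 * blockStart (j + 1) + 1 ≤ 2 ^ 2 ^ (j + 1) := by
  have h1 : 2 * blockStart (j + 1) = 2 ^ 2 ^ j := by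
    rw [blockStart, mul_comm, ← pow_succ, Nat.sub_add_cancel Nat.one_le_two_pow]
  have h2 : 2 ≤ 2 ^ 2 ^ j := by
    calc 2 = 2 ^ 1 := rfl
      _ ≤ _ := Nat.pow_le_pow_right (by norm_num) Nat.one_le_two_pow
  rw [h1, pow_succ 2 j, pow_mul]
  nlinarith

variable {X : Type*} [NormedAddCommGroup X] [NormedSpace ℝ X]

local notation "ℓ¹" => lp (fun _ : ℕ => ℝ) 1

/-- Entropy numbers of `S ∘ D_σ` along powers of two, in terms of `σ` at the block endpoints. -/
lemma exists_opDyadEntropyNum_le {p ρ q r : ℝ} (hp : 0 < p) (hρ : 0 < ρ)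
    (hX : IsTypePWith X p ρ) (hq : q = 1 - 1 / p) (hr : 0 < r) (hrq : 1 / r < q)
    {σ : ℕ → ℝ} (hσ0 : ∀ n, 0 ≤ σ n) (hσm : Antitone σ) (S : ℓ¹ →L[ℝ] X) (D : ℓ¹ →L[ℝ] ℓ¹)
    (hD : ∀ (ξ : ℓ¹) (n : ℕ), (D ξ : ∀ _ : ℕ, ℝ) n = σ n * (ξ : ∀ _ : ℕ, ℝ) n) :
    ∃ C u : ℝ, 0 ≤ C ∧ 0 < u ∧ u < 2 ^ (-(1 / r)) ∧ ∀ i : ℕ, ∃ j ≤ i,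
      opDyadEntropyNum (S.comp D) (2 ^ i) ≤ C * (σ (blockStart j) * u ^ (i - j)) := by
  have hr' : 0 < 1 / r := by positivity
  have hq0 : 0 < q := hr'.trans hrq
  obtain ⟨t, ht1, ht2⟩ : ∃ t : ℝ, (2 : ℝ) ^ (1 / r / q) < t ∧ t < 2 := by
    refine exists_between ?_
    calc (2 : ℝ) ^ (1 / r / q) < 2 ^ (1 : ℝ) :=
          Real.rpow_lt_rpow_of_exponent_lt (by norm_num) ((div_lt_one hq0).2 hrq)
      _ = 2 := Real.rpow_one 2
  have ht : 1 < t := (Real.one_lt_rpow (by norm_num) (by positivity)).trans ht1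
  have ht0 : 0 < t := by linarith
  set v := t ^ (-q) with hv
  have hv0 : 0 < v := Real.rpow_pos_of_pos ht0 _
  have hv1 : v < 2 ^ (-(1 / r)) := by
    calc v < ((2 : ℝ) ^ (1 / r / q)) ^ (-q) :=
          Real.rpow_lt_rpow_of_neg (by positivity) ht1 (by linarith)
      _ = 2 ^ (-(1 / r)) := by
          rw [← Real.rpow_mul (by norm_num)]
          congr 1
          field_simp
  obtain ⟨u, hvu, hu⟩ := exists_between hv1
  have hu0 : 0 < u := hv0.trans hvu
  have hu1 : u ≤ 1 :=
    hu.le.trans (Real.rpow_le_one_of_one_le_of_nonpos (by norm_num) (by linarith))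
  obtain ⟨c, hc⟩ := pow_unbounded_of_one_lt (4 * (1 - t / 2)⁻¹ + 1) (one_lt_two : (1 : ℝ) < 2)
  set B := (2 * ρ + 1) * ‖S‖ * (1 - v / u)⁻¹ with hB
  have hvu' : 0 < 1 - v / u := sub_pos.2 ((div_lt_one hu0).2 hvu)
  have hB0 : 0 ≤ B := by positivity
  refine ⟨B / u ^ c, u, by positivity, hu0, hu, fun i => ?_⟩
  set J := i - c with hJ
  obtain ⟨j, hjJ, hj⟩ := exists_sum_pow_le hv0 hvu (fun j => hσ0 (blockStart j)) J
  refine ⟨j, hjJ.trans (Nat.sub_le _ _), ?_⟩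
  set l : ℕ → ℕ := fun j => ⌈t ^ (J - j)⌉₊ with hl
  have hl1 : ∀ j, t ^ (J - j) ≤ l j := fun j => Nat.le_ceil _
  have hl2 : ∀ j, (l j : ℝ) ≤ 2 * t ^ (J - j) := fun j => by
    have h1 := (Nat.ceil_lt_add_one (by positivity : 0 ≤ t ^ (J - j))).le
    have h2 : 1 ≤ t ^ (J - j) := one_le_pow₀ ht.le
    linarith
  have hl0 : ∀ j, 0 < l j := fun j => Nat.ceil_pos.2 (by positivity)
  have hN : ∏ j ∈ Finset.range J, (2 * blockStart (j + 1) + 1) ^ l j ≤ 2 ^ (2 ^ i - 1) := by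
    have h1 : ∑ j ∈ Finset.range J, 2 ^ (j + 1) * l j ≤ 2 ^ i - 1 := by
      rcases Nat.eq_zero_or_pos J with h0 | h0
      · simp [h0]
      have hi : i = J + c := by omega
      refine Nat.le_sub_of_add_le ?_
      have h2 : ∑ j ∈ Finset.range J, (2 : ℝ) ^ (j + 1) * l j ≤
          4 * (1 - t / 2)⁻¹ * 2 ^ J := by
        calc _ ≤ ∑ j ∈ Finset.range J, (4 * 2 ^ J) * (t / 2) ^ (J - j) := by
              refine Finset.sum_le_sum fun j hj => ?_
              have hjJ : j ≤ J := (Finset.mem_range.1 hj).le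
              have h3 : (2 : ℝ) ^ J = 2 ^ j * 2 ^ (J - j) := by
                rw [← pow_add, Nat.add_sub_cancel' hjJ]
              calc (2 : ℝ) ^ (j + 1) * l j ≤ 2 ^ (j + 1) * (2 * t ^ (J - j)) :=
                    mul_le_mul_of_nonneg_left (hl2 j) (by positivity)
                _ = _ := by
                    rw [h3, div_pow]
                    field_simp
                    ring
          _ = (4 * 2 ^ J) * ∑ j ∈ Finset.range J, (t / 2) ^ (J - j) := by rw [Finset.mul_sum]
          _ ≤ (4 * 2 ^ J) * (1 - t / 2)⁻¹ := by
              refine mul_le_mul_of_nonneg_left ?_ (by positivity)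
              refine le_trans ?_ (sum_pow_sub_le (by positivity) (by linarith) J)
              exact Finset.sum_le_sum_of_subset_of_nonneg
                (Finset.range_mono J.le_succ) fun _ _ _ => by positivity
          _ = _ := by ring
      have h3 : (1 : ℝ) ≤ 2 ^ J := one_le_pow₀ (by norm_num)
      have h4 : ∑ j ∈ Finset.range J, (2 : ℝ) ^ (j + 1) * l j + 1 ≤ 2 ^ i := by
        rw [hi, pow_add]
        nlinarith
      exact_mod_cast h4
    refine le_trans ?_ (Nat.pow_le_pow_right (by norm_num) h1)
    rw [← Finset.prod_pow_eq_pow_sum]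
    refine Finset.prod_le_prod' fun j _ => ?_
    rw [pow_mul]
    exact Nat.pow_le_pow_left (two_mul_blockStart_succ_add_one_le j) _
  have hcov := (coveredBy_sum_blocks hp hρ.le hX
    (fun i => S (D (lp.single 1 i (1 : ℝ)))) blockStart_monotone rfl
    (M := fun j => ‖S‖ * σ (blockStart j)) (fun j => mul_nonneg (norm_nonneg _) (hσ0 _))
    (fun j i hi => norm_image_single_le hσ0 hσm S D hD hi) hl0 J).add
    (coveredBy_closedBall (X := X) (‖S‖ * σ (blockStart J)))
  have hR : ∑ j ∈ Finset.range J,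
      2 * ρ * (‖S‖ * σ (blockStart j)) * (l j : ℝ) ^ (1 / p - 1) + ‖S‖ * σ (blockStart J) ≤
      B * (σ (blockStart j) * u ^ (J - j)) := by
    have h1 : ∀ j, 2 * ρ * (‖S‖ * σ (blockStart j)) * (l j : ℝ) ^ (1 / p - 1) ≤
        (2 * ρ + 1) * ‖S‖ * (σ (blockStart j) * v ^ (J - j)) := by
      intro j
      have h2 : (l j : ℝ) ^ (1 / p - 1) ≤ v ^ (J - j) := by
        have h3 : v ^ (J - j) = (t ^ (J - j)) ^ (-q) := by
          rw [hv, ← Real.rpow_natCast, ← Real.rpow_natCast, ← Real.rpow_mul ht0.le,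
            ← Real.rpow_mul ht0.le, mul_comm]
        rw [h3, hq, neg_sub]
        exact Real.rpow_le_rpow_of_nonpos (by positivity) (hl1 j) (by linarith)
      have h3 : 0 ≤ ‖S‖ * σ (blockStart j) := mul_nonneg (norm_nonneg _) (hσ0 _)
      calc _ ≤ 2 * ρ * (‖S‖ * σ (blockStart j)) * v ^ (J - j) :=
            mul_le_mul_of_nonneg_left h2 (by positivity)
        _ ≤ (2 * ρ + 1) * (‖S‖ * σ (blockStart j)) * v ^ (J - j) := by gcongr; linarith
        _ = _ := by ring
    calc _ ≤ ∑ j ∈ Finset.range J, (2 * ρ + 1) * ‖S‖ * (σ (blockStart j) * v ^ (J - j)) +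
          (2 * ρ + 1) * ‖S‖ * (σ (blockStart J) * v ^ (J - J)) := by
          refine add_le_add (Finset.sum_le_sum fun j _ => h1 j) ?_
          have h3 : 0 ≤ ‖S‖ * σ (blockStart J) := mul_nonneg (norm_nonneg _) (hσ0 _)
          rw [Nat.sub_self, pow_zero]
          nlinarith
      _ = (2 * ρ + 1) * ‖S‖ *
          ∑ j ∈ Finset.range (J + 1), σ (blockStart j) * v ^ (J - j) := by
          rw [Finset.sum_range_succ, mul_add, Finset.mul_sum]
      _ ≤ (2 * ρ + 1) * ‖S‖ * ((1 - v / u)⁻¹ * (σ (blockStart j) * u ^ (J - j))) :=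
          mul_le_mul_of_nonneg_left hj (by positivity)
      _ = _ := by rw [hB]; ring
  have hE := (hcov.mono (image_diagonal_subset hσ0 hσm S D hD (blockStart J))
    ((mul_one _).trans_le hN) hR).entropyNum_le
      (mul_nonneg hB0 (mul_nonneg (hσ0 _) (by positivity)))
  refine hE.trans ?_
  have hpow : u ^ (J - j) ≤ u ^ (i - j) / u ^ c := by
    rw [le_div_iff₀ (by positivity), ← pow_add]
    exact pow_le_pow_of_le_one hu0.le hu1 (by omega)
  calc _ ≤ B * (σ (blockStart j) * (u ^ (i - j) / u ^ c)) := by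
        have := hσ0 (blockStart j)
        gcongr
    _ = _ := by ring

end DyadicBound

section LorentzCondensation

lemma rpow_le_of_comparable {x y : ℝ} (hy : 0 < y) (hxy : y / 4 ≤ x) (hyx : x ≤ 4 * y) (a : ℝ) :
    x ^ a ≤ 4 ^ |a| * y ^ a := by
  have hx : 0 < x := lt_of_lt_of_le (by positivity) hxy
  rcases le_total 0 a with ha | ha
  · rw [abs_of_nonneg ha, ← Real.mul_rpow (by norm_num) hy.le]
    exact Real.rpow_le_rpow hx.le hyx ha
  · calc x ^ a ≤ (y / 4) ^ a := Real.rpow_le_rpow_of_nonpos (by positivity) hxy ha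
      _ = 4 ^ |a| * y ^ a := by
        rw [abs_of_nonpos ha, Real.div_rpow hy.le (by norm_num), Real.rpow_neg (by norm_num)]
        field_simp

lemma weight_comparable {n j d : ℕ} (h1 : 2 ^ j ≤ n) (h2 : n < 2 ^ (j + 1)) (hd1 : j ≤ d)
    (hd2 : d ≤ j + 1) (a b : ℝ) :
    Real.logb 2 ((n : ℝ) + 1) ^ a * (n : ℝ) ^ b ≤
        4 ^ |a| * 4 ^ |b| * (((d : ℝ) + 1) ^ a * ((2 : ℝ) ^ d) ^ b) ∧
      ((d : ℝ) + 1) ^ a * ((2 : ℝ) ^ d) ^ b ≤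
        4 ^ |a| * 4 ^ |b| * (Real.logb 2 ((n : ℝ) + 1) ^ a * (n : ℝ) ^ b) := by
  have h1' : (2 : ℝ) ^ j ≤ n := by exact_mod_cast h1
  have h2' : (n : ℝ) + 1 ≤ 2 ^ (j + 1) := by exact_mod_cast h2
  have hj0 : (1 : ℝ) ≤ 2 ^ j := one_le_pow₀ (by norm_num)
  have hn : (0 : ℝ) < n := by linarith
  have hL1 : (j : ℝ) ≤ Real.logb 2 ((n : ℝ) + 1) := by
    rw [Real.le_logb_iff_rpow_le (by norm_num) (by positivity), Real.rpow_natCast]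
    linarith
  have hL2 : 1 ≤ Real.logb 2 ((n : ℝ) + 1) := by
    rw [Real.le_logb_iff_rpow_le (by norm_num) (by positivity), Real.rpow_one]
    linarith
  have hL3 : Real.logb 2 ((n : ℝ) + 1) ≤ j + 1 := by
    rw [Real.logb_le_iff_le_rpow (by norm_num) (by positivity)]
    exact_mod_cast h2
  have hd1' : (j : ℝ) ≤ d := by exact_mod_cast hd1
  have hd2' : (d : ℝ) ≤ j + 1 := by exact_mod_cast hd2
  have hp1 : (2 : ℝ) ^ j ≤ 2 ^ d := pow_le_pow_right₀ (by norm_num) hd1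
  have hp2 : (2 : ℝ) ^ d ≤ 2 ^ (j + 1) := pow_le_pow_right₀ (by norm_num) hd2
  have hp3 : (2 : ℝ) ^ (j + 1) = 2 * 2 ^ j := by rw [pow_succ, mul_comm]
  have hd0 : (0 : ℝ) < (d : ℝ) + 1 := by positivity
  constructor
  · have := mul_le_mul
      (rpow_le_of_comparable hd0 (x := Real.logb 2 ((n : ℝ) + 1)) (by linarith) (by linarith) a)
      (rpow_le_of_comparable (y := (2 : ℝ) ^ d) (x := n) (by positivity) (by linarith)
        (by linarith) b) (by positivity)
      (by positivity)
    linarith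
  · have := mul_le_mul
      (rpow_le_of_comparable (y := Real.logb 2 ((n : ℝ) + 1)) (x := (d : ℝ) + 1) (by linarith)
        (by linarith) (by linarith) a)
      (rpow_le_of_comparable (x := (2 : ℝ) ^ d) hn (by linarith) (by linarith) b)
      (by positivity) (mul_nonneg (by positivity) (Real.rpow_nonneg (by linarith) _))
    linarith

/-- The weight of `l_{r,∞,β}` at `2 ^ d`, up to constants. -/
noncomputable def dyadicWeight (r β : ℝ) (d : ℕ) : ℝ :=
  ((d : ℝ) + 1) ^ (-β) * ((2 : ℝ) ^ d) ^ (1 / r)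

lemma dyadicWeight_pos (r β : ℝ) (d : ℕ) : 0 < dyadicWeight r β d := by
  unfold dyadicWeight
  positivity

lemma dyadicWeight_mul_rpow (r s β : ℝ) (d : ℕ) {x : ℝ} (hx : 0 ≤ x) :
    (dyadicWeight r β d * x) ^ s =
      2 ^ d * (((d : ℝ) + 1) ^ (-(β * s)) * ((2 : ℝ) ^ d) ^ (s / r - 1) * x ^ s) := by
  have h2 : (0 : ℝ) < 2 ^ d := by positivity
  rw [Real.mul_rpow (dyadicWeight_pos r β d).le hx, dyadicWeight,
    Real.mul_rpow (by positivity) (by positivity), ← Real.rpow_mul (by positivity),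
    ← Real.rpow_mul h2.le, Real.rpow_sub_one h2.ne']
  have h3 : 1 / r * s = s / r := by ring
  rw [h3, neg_mul]
  field_simp

lemma dyadicWeight_succ_le (r β : ℝ) :
    ∃ A > 0, ∀ d, dyadicWeight r β (d + 1) ≤ A * dyadicWeight r β d := by
  refine ⟨4 ^ |-β| * 4 ^ |1 / r| * (4 ^ |-β| * 4 ^ |1 / r|), by positivity, fun d => ?_⟩
  have hlt : 2 ^ d < 2 ^ (d + 1) := Nat.pow_lt_pow_right (by norm_num) d.lt_succ_self
  refine (weight_comparable (d := d + 1) le_rfl hlt d.le_succ le_rfl (-β) (1 / r)).2.trans ?_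
  rw [mul_assoc (4 ^ |-β| * 4 ^ |1 / r|) _ (dyadicWeight r β d)]
  exact mul_le_mul_of_nonneg_left
    (weight_comparable (d := d) le_rfl hlt le_rfl d.le_succ (-β) (1 / r)).1 (by positivity)

lemma sum_Ico_two_pow (F : ℕ → ℝ) (N : ℕ) : ∑ n ∈ Finset.Ico 1 (2 ^ N), F n =
    ∑ j ∈ Finset.range N, ∑ n ∈ Finset.Ico (2 ^ j) (2 ^ (j + 1)), F n := by
  induction N with
  | zero => simp
  | succ N ih =>
    rw [Finset.sum_range_succ, ← ih, Finset.sum_Ico_consecutive _ Nat.one_le_two_pow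
      (Nat.pow_le_pow_right (by norm_num) N.le_succ)]

/-- Cauchy condensation for the generalized Lorentz sequence spaces. -/
lemma memLorentz_iff {r s β : ℝ} (hs : 0 < s) {ξ : ℕ → ℝ} (hξ0 : ∀ n, 0 ≤ ξ n)
    (hξ : Antitone ξ) :
    MemLorentz r s β ξ ↔ Summable fun d => (dyadicWeight r β d * ξ (2 ^ d)) ^ s := by
  set F : ℕ → ℝ := fun n =>
    Real.logb 2 ((n : ℝ) + 1) ^ (-(β * s)) * (n : ℝ) ^ (s / r - 1) * ξ n ^ s with hF
  have hF0 : ∀ n, 0 ≤ F n := fun n => by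
    have h : 0 ≤ Real.logb 2 ((n : ℝ) + 1) :=
      Real.logb_nonneg (by norm_num) (by linarith [Nat.cast_nonneg (α := ℝ) n])
    have := hξ0 n
    positivity
  have hmem : MemLorentz r s β ξ ↔ Summable fun n => F (n + 1) := by
    unfold MemLorentz
    refine summable_congr fun n => ?_
    simp only [hF]
    push_cast
    congr 4
    ring
  rw [hmem]
  set A : ℝ := 4 ^ |-(β * s)| * 4 ^ |s / r - 1| with hA
  have hA0 : 0 < A := by positivity
  have hcard : ∀ j, (((Finset.Ico (2 ^ j) (2 ^ (j + 1)) : Finset ℕ).card : ℕ) : ℝ) = 2 ^ j := by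
    intro j
    have : (Finset.Ico (2 ^ j) (2 ^ (j + 1)) : Finset ℕ).card = 2 ^ j := by
      rw [Nat.card_Ico, pow_succ]
      omega
    rw [this]
    push_cast
    rfl
  have hg0 : ∀ d, 0 ≤ (dyadicWeight r β d * ξ (2 ^ d)) ^ s := fun d =>
    Real.rpow_nonneg (mul_nonneg (dyadicWeight_pos r β d).le (hξ0 _)) _
  constructor
  · intro hsum
    rw [← summable_nat_add_iff 1]
    refine summable_of_sum_range_le (c := 2 * A * ∑' n, F (n + 1)) (fun d => hg0 _) fun N => ?_
    have hblock : ∀ j, (dyadicWeight r β (j + 1) * ξ (2 ^ (j + 1))) ^ s ≤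
        2 * A * ∑ n ∈ Finset.Ico (2 ^ j) (2 ^ (j + 1)), F n := by
      intro j
      have hn : ∀ n ∈ Finset.Ico (2 ^ j) (2 ^ (j + 1)),
          (dyadicWeight r β (j + 1) * ξ (2 ^ (j + 1))) ^ s / 2 ^ (j + 1) ≤ A * F n := by
        intro n hn
        obtain ⟨h1, h2⟩ := Finset.mem_Ico.1 hn
        rw [dyadicWeight_mul_rpow r s β _ (hξ0 _), mul_div_cancel_left₀ _ (by positivity)]
        have h3 := (weight_comparable (d := j + 1) h1 h2 j.le_succ le_rfl
          (-(β * s)) (s / r - 1)).2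
        have h4 : ξ (2 ^ (j + 1)) ^ s ≤ ξ n ^ s := Real.rpow_le_rpow (hξ0 _) (hξ h2.le) hs.le
        have h5 := hξ0 (2 ^ (j + 1))
        refine (mul_le_mul h3 h4 (by positivity) (le_trans (by positivity) h3)).trans_eq ?_
        simp only [hF, hA]
        ring
      have := Finset.sum_le_sum hn
      rw [Finset.sum_const, nsmul_eq_mul, hcard, ← Finset.mul_sum] at this
      have h6 : (2 : ℝ) ^ j * ((dyadicWeight r β (j + 1) * ξ (2 ^ (j + 1))) ^ s / 2 ^ (j + 1)) =
          (dyadicWeight r β (j + 1) * ξ (2 ^ (j + 1))) ^ s / 2 := by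
        rw [pow_succ (2 : ℝ)]
        field_simp
      rw [h6] at this
      linarith
    refine (Finset.sum_le_sum fun j _ => hblock j).trans ?_
    rw [← Finset.mul_sum, ← sum_Ico_two_pow]
    refine mul_le_mul_of_nonneg_left ?_ (by positivity)
    rw [Finset.sum_Ico_eq_sum_range]
    refine le_trans (le_of_eq (Finset.sum_congr rfl fun n _ => by rw [add_comm]))
      (hsum.sum_le_tsum _ fun n _ => hF0 _)
  · intro hsum
    refine summable_of_sum_range_le
      (c := A * ∑' d, (dyadicWeight r β d * ξ (2 ^ d)) ^ s) (fun n => hF0 _) fun N => ?_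
    have hblock : ∀ j, ∑ n ∈ Finset.Ico (2 ^ j) (2 ^ (j + 1)), F n ≤
        A * (dyadicWeight r β j * ξ (2 ^ j)) ^ s := by
      intro j
      have hn : ∀ n ∈ Finset.Ico (2 ^ j) (2 ^ (j + 1)),
          F n ≤ A * ((dyadicWeight r β j * ξ (2 ^ j)) ^ s / 2 ^ j) := by
        intro n hn
        obtain ⟨h1, h2⟩ := Finset.mem_Ico.1 hn
        rw [dyadicWeight_mul_rpow r s β _ (hξ0 _), mul_div_cancel_left₀ _ (by positivity)]
        have h3 := (weight_comparable (d := j) h1 h2 le_rfl j.le_succ (-(β * s)) (s / r - 1)).1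
        have h4 : ξ n ^ s ≤ ξ (2 ^ j) ^ s := Real.rpow_le_rpow (hξ0 _) (hξ h1) hs.le
        have h5 := hξ0 n
        refine (mul_le_mul h3 h4 (by positivity) (by positivity)).trans_eq ?_
        simp only [hA]
        ring
      refine (Finset.sum_le_sum hn).trans (le_of_eq ?_)
      rw [Finset.sum_const, nsmul_eq_mul, hcard]
      field_simp
    calc ∑ n ∈ Finset.range N, F (n + 1) = ∑ n ∈ Finset.Ico 1 (N + 1), F n := by
          rw [Finset.sum_Ico_eq_sum_range, Nat.add_sub_cancel]
          exact Finset.sum_congr rfl fun n _ => by rw [add_comm]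
      _ ≤ ∑ n ∈ Finset.Ico 1 (2 ^ N), F n :=
          Finset.sum_le_sum_of_subset_of_nonneg
            (Finset.Ico_subset_Ico_right (Nat.lt_two_pow_self)) fun n _ _ => hF0 n
      _ ≤ ∑ j ∈ Finset.range N, A * (dyadicWeight r β j * ξ (2 ^ j)) ^ s := by
          rw [sum_Ico_two_pow]
          exact Finset.sum_le_sum fun j _ => hblock j
      _ ≤ _ := by
          rw [← Finset.mul_sum]
          exact mul_le_mul_of_nonneg_left (hsum.sum_le_tsum _ fun d _ => hg0 d) hA0.le

lemma memLorentzTop_iff {r β : ℝ} {ξ : ℕ → ℝ} (hξ0 : ∀ n, 0 ≤ ξ n) (hξ : Antitone ξ) :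
    MemLorentzTop r β ξ ↔ ∃ B : ℝ, ∀ d, dyadicWeight r β d * ξ (2 ^ d) ≤ B := by
  set A : ℝ := 4 ^ |-β| * 4 ^ |1 / r| with hA
  have hA0 : 0 < A := by positivity
  constructor
  · rintro ⟨C, hC⟩
    refine ⟨A * C, fun d => ?_⟩
    have h1 := (weight_comparable (d := d) le_rfl
      (Nat.pow_lt_pow_right (by norm_num) d.lt_succ_self) le_rfl d.le_succ (-β) (1 / r)).2
    refine (mul_le_mul_of_nonneg_right h1 (hξ0 _)).trans ?_
    rw [mul_assoc]
    exact mul_le_mul_of_nonneg_left (hC (2 ^ d) Nat.one_le_two_pow) hA0.le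
  · rintro ⟨B, hB⟩
    refine ⟨A * B, fun n hn => ?_⟩
    have hlog := Nat.pow_log_le_self 2 (Nat.one_le_iff_ne_zero.1 hn)
    have h1 := (weight_comparable (d := Nat.log 2 n) hlog
      (Nat.lt_pow_succ_log_self (by norm_num) n) le_rfl (Nat.le_succ _) (-β) (1 / r)).1
    refine (mul_le_mul_of_nonneg_right h1 (hξ0 _)).trans ?_
    rw [mul_assoc]
    refine mul_le_mul_of_nonneg_left ?_ hA0.le
    exact (mul_le_mul_of_nonneg_left (hξ hlog) (dyadicWeight_pos r β _).le).trans (hB _)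

lemma exists_dyadicWeight_mul_pow_le {r β u : ℝ} (hu0 : 0 < u) (hu : u < 2 ^ (-(1 / r))) :
    ∃ K κ : ℝ, 0 < K ∧ 0 < κ ∧ κ < 1 ∧ ∀ i j : ℕ, j ≤ i →
      dyadicWeight r β i * u ^ (i - j) ≤ K * (dyadicWeight r β j * κ ^ (i - j)) := by
  set w : ℝ := 2 ^ (1 / r) * u with hw
  have hw0 : 0 < w := by positivity
  have hw1 : w < 1 := by
    calc w < (2 : ℝ) ^ (1 / r) * 2 ^ (-(1 / r)) := mul_lt_mul_of_pos_left hu (by positivity)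
      _ = 1 := by rw [← Real.rpow_add (by norm_num)]; simp
  obtain ⟨κ, hwκ, hκ1⟩ := exists_between hw1
  have hκ0 : 0 < κ := hw0.trans hwκ
  set x := w / κ with hx
  have hx0 : 0 < x := by positivity
  have hx1 : x < 1 := (div_lt_one hκ0).2 hwκ
  set k := ⌈|β|⌉₊ with hk
  obtain ⟨K, hK⟩ := (tendsto_pow_const_mul_const_pow_of_abs_lt_one k
    (by rwa [abs_of_pos hx0] : |x| < 1)).bddAbove_range
  have hK' : ∀ n : ℕ, (n : ℝ) ^ k * x ^ n ≤ K := fun n => hK ⟨n, rfl⟩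
  have hK0 : 0 < K := by
    have := hK' 1
    simp only [Nat.cast_one, one_pow, one_mul, pow_one] at this
    linarith
  refine ⟨K / x, κ, by positivity, hκ0, hκ1, fun i j hji => ?_⟩
  obtain ⟨n, rfl⟩ := Nat.exists_eq_add_of_le hji
  rw [Nat.add_sub_cancel_left]
  have hratio : (((j + n : ℕ) : ℝ) + 1) ^ (-β) ≤ ((n : ℝ) + 1) ^ k * ((j : ℝ) + 1) ^ (-β) := by
    have hj : (0 : ℝ) < (j : ℝ) + 1 := by positivity
    have h1 : 1 ≤ (((j + n : ℕ) : ℝ) + 1) / ((j : ℝ) + 1) := by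
      rw [one_le_div hj]
      push_cast
      linarith [Nat.cast_nonneg (α := ℝ) n]
    have h2 : (((j + n : ℕ) : ℝ) + 1) / ((j : ℝ) + 1) ≤ (n : ℝ) + 1 := by
      rw [div_le_iff₀ hj]
      push_cast
      nlinarith [Nat.cast_nonneg (α := ℝ) n, Nat.cast_nonneg (α := ℝ) j]
    have h3 : ((((j + n : ℕ) : ℝ) + 1) / ((j : ℝ) + 1)) ^ (-β) ≤ ((n : ℝ) + 1) ^ k := by
      rw [← Real.rpow_natCast]
      calc _ ≤ ((((j + n : ℕ) : ℝ) + 1) / ((j : ℝ) + 1)) ^ (k : ℝ) :=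
            Real.rpow_le_rpow_of_exponent_le h1 ((neg_le_abs β).trans (Nat.le_ceil _))
        _ ≤ _ := Real.rpow_le_rpow (by linarith) h2 (by positivity)
    rwa [Real.div_rpow (by positivity) hj.le, div_le_iff₀ (by positivity)] at h3
  have hpow : ((2 : ℝ) ^ (j + n)) ^ (1 / r) * u ^ n = ((2 : ℝ) ^ j) ^ (1 / r) * w ^ n := by
    rw [pow_add, Real.mul_rpow (by positivity) (by positivity), hw, mul_pow,
      ← Real.rpow_natCast (2 ^ (1 / r)), ← Real.rpow_natCast 2 n,
      ← Real.rpow_mul (by norm_num), ← Real.rpow_mul (by norm_num), mul_comm (n : ℝ)]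
    ring
  have hwx : w ^ n = x ^ n * κ ^ n := by
    rw [hx, div_pow]
    field_simp
  have hkx : ((n : ℝ) + 1) ^ k * x ^ n ≤ K / x := by
    rw [le_div_iff₀ hx0]
    have := hK' (n + 1)
    push_cast at this
    rwa [mul_assoc, ← pow_succ]
  unfold dyadicWeight
  calc _ = (((j + n : ℕ) : ℝ) + 1) ^ (-β) * (((2 : ℝ) ^ (j + n)) ^ (1 / r) * u ^ n) := by ring
    _ ≤ ((n : ℝ) + 1) ^ k * ((j : ℝ) + 1) ^ (-β) * (((2 : ℝ) ^ (j + n)) ^ (1 / r) * u ^ n) :=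
        mul_le_mul_of_nonneg_right hratio (by positivity)
    _ = (((n : ℝ) + 1) ^ k * x ^ n) *
          (((j : ℝ) + 1) ^ (-β) * ((2 : ℝ) ^ j) ^ (1 / r) * κ ^ n) := by
        rw [hpow, hwx]
        ring
    _ ≤ _ := mul_le_mul_of_nonneg_right hkx (by positivity)

/-- A discrete Hardy inequality for a geometric maximal bound. -/
lemma summable_rpow_of_geometric_bound {s K κ : ℝ} (hs : 0 < s) (hK : 0 ≤ K) (hκ0 : 0 < κ)
    (hκ1 : κ < 1) {b e : ℕ → ℝ} (hb : ∀ j, 0 ≤ b j) (he : ∀ j, 0 ≤ e j)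
    (h : ∀ i, ∃ j ≤ i, e i ≤ K * (b j * κ ^ (i - j))) (hsum : Summable fun j => b j ^ s) :
    Summable fun i => e i ^ s := by
  have hκs : κ ^ s < 1 := Real.rpow_lt_one hκ0.le hκ1 hs
  have hκs0 : 0 ≤ κ ^ s := by positivity
  have hconv := summable_norm_sum_mul_range_of_summable_norm (hsum.norm)
    (summable_geometric_of_lt_one hκs0 hκs).norm
  refine Summable.of_nonneg_of_le (fun i => Real.rpow_nonneg (he i) _) (fun i => ?_)
    (hconv.mul_left (K ^ s))
  obtain ⟨j, hj, hle⟩ := h i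
  have h1 : ∀ j, 0 ≤ b j ^ s * (κ ^ s) ^ (i - j) := fun j =>
    mul_nonneg (Real.rpow_nonneg (hb j) _) (by positivity)
  calc e i ^ s ≤ (K * (b j * κ ^ (i - j))) ^ s := Real.rpow_le_rpow (he i) hle hs.le
    _ = K ^ s * (b j ^ s * (κ ^ s) ^ (i - j)) := by
        rw [Real.mul_rpow hK (mul_nonneg (hb j) (by positivity)),
          Real.mul_rpow (hb j) (by positivity), ← Real.rpow_natCast, ← Real.rpow_natCast,
          ← Real.rpow_mul hκ0.le, ← Real.rpow_mul hκ0.le, mul_comm s]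
    _ ≤ _ := by
        refine mul_le_mul_of_nonneg_left ?_ (by positivity)
        rw [Real.norm_of_nonneg (Finset.sum_nonneg fun j _ => h1 j)]
        exact Finset.single_le_sum (f := fun j => b j ^ s * (κ ^ s) ^ (i - j))
          (fun j _ => h1 j) (Finset.mem_range.2 (Nat.lt_succ_of_le hj))

end LorentzCondensation

/-- `X` Banach of type `p`, `1 < p ≤ 2`, `S : l₁ → X` bounded,
`D_σ : l₁ → l₁` the diagonal operator of a non-increasing non-negative `σ`, `T = S D_σ`.
If `p' < r < ∞`, `0 < s ≤ ∞` and `β ∈ ℝ`, then `(σ_{2^{n-1}}) ∈ l_{r,s,β}` implies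
`(e_n(T)) ∈ l_{r,s,β}`. -/
theorem stmt7 {X : Type*} [NormedAddCommGroup X] [NormedSpace ℝ X] [CompleteSpace X]
    (p p' r β : ℝ) (hp1 : 1 < p) (hp2 : p ≤ 2) (hX : IsTypeP X p)
    (hp' : 1 / p + 1 / p' = 1) (hrp : p' < r)
    (σ : ℕ → ℝ) (hσ0 : ∀ n, 0 ≤ σ n) (hσm : Antitone σ)
    (S : lp (fun _ : ℕ => ℝ) 1 →L[ℝ] X)
    (D : lp (fun _ : ℕ => ℝ) 1 →L[ℝ] lp (fun _ : ℕ => ℝ) 1)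
    (hD : ∀ (ξ : lp (fun _ : ℕ => ℝ) 1) (n : ℕ), (D ξ : ∀ _ : ℕ, ℝ) n = σ n * (ξ : ∀ _ : ℕ, ℝ) n) :
    (∀ s : ℝ, 0 < s →
      (MemLorentz r s β fun n => σ (2 ^ (n - 1))) →
        MemLorentz r s β fun n => opDyadEntropyNum (S.comp D) n) ∧
    ((MemLorentzTop r β fun n => σ (2 ^ (n - 1))) →
      MemLorentzTop r β fun n => opDyadEntropyNum (S.comp D) n) := by
  obtain ⟨ρ, hρ, hXρ⟩ := hX
  have hp0 : 0 < p := by linarith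
  have hq : 1 / p' = 1 - 1 / p := by linarith
  have hq0 : 0 < 1 / p' := by
    rw [hq, sub_pos, div_lt_one hp0]
    exact hp1
  have hp'0 : 0 < p' := one_div_pos.1 hq0
  have hr : 0 < r := hp'0.trans hrp
  have hrq : 1 / r < 1 / p' := one_div_lt_one_div_of_lt hp'0 hrp
  obtain ⟨C, u, hC, hu0, hu, hE⟩ :=
    exists_opDyadEntropyNum_le hp0 hρ hXρ hq hr hrq hσ0 hσm S D hD
  obtain ⟨K, κ, hK, hκ0, hκ1, hKκ⟩ := exists_dyadicWeight_mul_pow_le (β := β) hu0 hu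
  obtain ⟨A, hA, hAw⟩ := dyadicWeight_succ_le r β
  set b : ℕ → ℝ := fun j => dyadicWeight r β j * σ (blockStart j) with hb
  set e : ℕ → ℝ := opDyadEntropyNum (S.comp D) with he
  have hw := dyadicWeight_pos r β
  have hb0 : ∀ j, 0 ≤ b j := fun j => mul_nonneg (hw j).le (hσ0 _)
  have he0 : ∀ n, 0 ≤ e n := opDyadEntropyNum_nonneg _
  have hmain : ∀ i, ∃ j ≤ i, dyadicWeight r β i * e (2 ^ i) ≤ C * K * (b j * κ ^ (i - j)) := by
    intro i
    obtain ⟨j, hj, hle⟩ := hE i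
    refine ⟨j, hj, (mul_le_mul_of_nonneg_left hle (hw i).le).trans ?_⟩
    calc _ = C * σ (blockStart j) * (dyadicWeight r β i * u ^ (i - j)) := by ring
      _ ≤ C * σ (blockStart j) * (K * (dyadicWeight r β j * κ ^ (i - j))) :=
          mul_le_mul_of_nonneg_left (hKκ i j hj) (mul_nonneg hC (hσ0 _))
      _ = _ := by simp only [hb]; ring
  have hξ : Antitone fun n => σ (2 ^ (n - 1)) := fun m n hmn =>
    hσm (Nat.pow_le_pow_right (by norm_num) (by omega))
  have hbsucc : ∀ j, b (j + 1) ≤ A * (dyadicWeight r β j * σ (2 ^ (2 ^ j - 1))) := by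
    intro j
    rw [← mul_assoc]
    exact mul_le_mul_of_nonneg_right (hAw j) (hσ0 _)
  constructor
  · intro s hs hmem
    rw [memLorentz_iff hs (fun n => hσ0 _) hξ] at hmem
    refine (memLorentz_iff hs he0 (opDyadEntropyNum_antitone _)).2 ?_
    refine summable_rpow_of_geometric_bound hs (mul_nonneg hC hK.le) hκ0 hκ1 hb0
      (fun i => mul_nonneg (hw i).le (he0 _)) hmain ?_
    rw [← summable_nat_add_iff 1]
    refine Summable.of_nonneg_of_le (fun j => Real.rpow_nonneg (hb0 _) _) (fun j => ?_)
      (hmem.mul_left (A ^ s))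
    refine (Real.rpow_le_rpow (hb0 _) (hbsucc j) hs.le).trans_eq ?_
    rw [Real.mul_rpow hA.le (mul_nonneg (hw j).le (hσ0 _))]
  · intro hmem
    obtain ⟨B, hB⟩ := (memLorentzTop_iff (fun n => hσ0 _) hξ).1 hmem
    refine (memLorentzTop_iff he0 (opDyadEntropyNum_antitone _)).2
      ⟨C * K * max (b 0) (A * B), fun i => ?_⟩
    obtain ⟨j, -, hle⟩ := hmain i
    refine hle.trans (mul_le_mul_of_nonneg_left ?_ (mul_nonneg hC hK.le))
    refine (mul_le_of_le_one_right (hb0 j) (pow_le_one₀ hκ0.le hκ1.le)).trans ?_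
    cases j with
    | zero => exact le_max_left _ _
    | succ j =>
      exact ((hbsucc j).trans (mul_le_mul_of_nonneg_left (hB j) hA.le)).trans (le_max_right _ _)
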